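/- Let p be an imitation kernel and let λ be a probability vector on G invariant for P̂ = Σ_{k∈A} θ_k P_(k), i.e. λP̂ = λ. Then there exists a shift-invariant probability measure μ ∈ 𝒢(p) whose single-site marginals equal λ, i.e. μ({x : x_n = g}) = λ(g) for every n ∈ ℤ and g ∈ G. -/

import Mathlib

open MeasureTheory
open scoped BigOperators

/-- The matrix of a word `𝐚 = (a_1, …, a_n)` (encoded as a list `[a_1, …, a_n]`),
namely `P_𝐚 = P_(a_n) ⋯ P_(a_1)`, so that `wordK P l i j` is the `(i,j)` entry. -/
noncomputable def wordK {G : Type*} [Fintype G] [DecidableEq G]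
    (P : ℕ → G → G → ℝ) : List ℕ → G → G → ℝ
  | [] => fun i j => if i = j then 1 else 0
  | a :: l => fun i j => ∑ m, wordK P l i m * P a m j

/-- A word over the alphabet `A`: a nonempty finite tuple with entries in `A`. -/
def IsWord (A : Set ℕ) (l : List ℕ) : Prop := l ≠ [] ∧ ∀ a ∈ l, a ∈ A

/-- `i` communicates with `j` if `P_𝐚(i,j) > 0` for some word `𝐚`. -/
def Communicates {G : Type*} [Fintype G] [DecidableEq G]
    (A : Set ℕ) (P : ℕ → G → G → ℝ) (i j : G) : Prop :=
  ∃ l : List ℕ, IsWord A l ∧ 0 < wordK P l i j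

/-- `i` and `j` intercommunicate (every state intercommunicates with itself). -/
def Intercommunicates {G : Type*} [Fintype G] [DecidableEq G]
    (A : Set ℕ) (P : ℕ → G → G → ℝ) (i j : G) : Prop :=
  i = j ∨ (Communicates A P i j ∧ Communicates A P j i)

/-- An intercommunicating class: an equivalence class of the intercommunication relation. -/
def IsInterClass {G : Type*} [Fintype G] [DecidableEq G]
    (A : Set ℕ) (P : ℕ → G → G → ℝ) (C : Set G) : Prop :=
  ∃ i : G, C = {j | Intercommunicates A P i j}

/-- A set `C` is closed if whenever `i ∈ C` communicates with `j`, then `j ∈ C`. -/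
def IsClosedClass {G : Type*} [Fintype G] [DecidableEq G]
    (A : Set ℕ) (P : ℕ → G → G → ℝ) (C : Set G) : Prop :=
  ∀ i ∈ C, ∀ j : G, Communicates A P i j → j ∈ C

/-- `d` is the greatest common divisor of the set `S ⊆ ℕ`. -/
def IsGCDOfSet (S : Set ℕ) (d : ℕ) : Prop :=
  (∀ n ∈ S, d ∣ n) ∧ ∀ e : ℕ, (∀ n ∈ S, e ∣ n) → e ∣ d

/-- The set of depths `s(𝐚)` of words `𝐚` with `P_𝐚(i,i) > 0`. -/
def ReturnDepths {G : Type*} [Fintype G] [DecidableEq G]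
    (A : Set ℕ) (P : ℕ → G → G → ℝ) (i : G) : Set ℕ :=
  {s | ∃ l : List ℕ, IsWord A l ∧ 0 < wordK P l i i ∧ l.sum = s}

/-- `E` is measurable with respect to the coordinates `(x_m)_{m < n}`. -/
def PastMeasurable {G : Type*} [MeasurableSpace G] (n : ℤ) (E : Set (ℤ → G)) : Prop :=
  MeasurableSet[MeasurableSpace.comap
    (fun x : ℤ → G => fun m : {m : ℤ // m < n} => x m.1) MeasurableSpace.pi] E

/-- `μ` is compatible with the imitation kernel
`p(g | w_{-1}, w_{-2}, …) = ∑_{k ∈ A} θ_k P_(k)(w_{-k}, g)` (here `θ` vanishes off `A`). -/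
def Compatible {G : Type*} [MeasurableSpace G] (θ : ℕ → ℝ) (P : ℕ → G → G → ℝ)
    (μ : Measure (ℤ → G)) : Prop :=
  ∀ (n : ℤ) (g : G) (E : Set (ℤ → G)), PastMeasurable n E →
    (μ (E ∩ {x | x n = g})).toReal
      = ∫ x in E, (∑' k : ℕ, θ k * P k (x (n - (k : ℤ))) g) ∂μ

open Filter Topology

/-- An ultrafilter limit of normalized positive functionals on a compact space is the integral
against a probability measure. -/
lemma exists_isProbabilityMeasure_tendsto_integral {ι X : Type*} [TopologicalSpace X]
    [CompactSpace X] [T2Space X] [MeasurableSpace X] [BorelSpace X] (U : Ultrafilter ι)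
    (M : ι → (X → ℝ) →ₗ[ℝ] ℝ) (hpos : ∀ i f, 0 ≤ f → 0 ≤ M i f) (hone : ∀ i, M i 1 = 1) :
    ∃ μ : Measure X, IsProbabilityMeasure μ ∧
      ∀ f : X → ℝ, Continuous f → Tendsto (fun i => M i f) U (𝓝 (∫ x, f x ∂μ)) := by
  have hmono : ∀ i f g, f ≤ g → M i f ≤ M i g := fun i f g h => by
    have := hpos i (g - f) (sub_nonneg.2 h)
    rw [map_sub] at this
    linarith
  have hconst : ∀ i c, M i (fun _ => c) = c := fun i c => by
    have : (fun _ : X => c) = c • (1 : X → ℝ) := by ext; simp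
    rw [this, map_smul, hone, smul_eq_mul, mul_one]
  have hlim : ∀ f : CompactlySupportedContinuousMap X ℝ,
      ∃ l, Tendsto (fun i => M i f) U (𝓝 l) := by
    intro f
    obtain ⟨C, hC⟩ := isCompact_univ.exists_bound_of_continuousOn f.continuous.continuousOn
    have hmem : ∀ i, M i f ∈ Set.Icc (-C) C := fun i =>
      ⟨by simpa only [hconst] using
          hmono i (fun _ => -C) f fun x => (abs_le.1 (hC x (Set.mem_univ x))).1,
        by simpa only [hconst] using
          hmono i f (fun _ => C) fun x => (abs_le.1 (hC x (Set.mem_univ x))).2⟩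
    obtain ⟨l, -, hl⟩ := isCompact_Icc.ultrafilter_le_nhds (U.map fun i => M i f)
      (le_principal_iff.2 (Filter.mem_map.2 (Filter.univ_mem' hmem)))
    exact ⟨l, hl⟩
  choose Λ hΛ using hlim
  let Λ' : CompactlySupportedContinuousMap X ℝ →ₚ[ℝ] ℝ := PositiveLinearMap.mk₀
    { toFun := Λ
      map_add' := fun f g => tendsto_nhds_unique (hΛ (f + g)) (by
        simpa only [CompactlySupportedContinuousMap.coe_add, map_add] using (hΛ f).add (hΛ g))
      map_smul' := fun c f => tendsto_nhds_unique (hΛ (c • f)) (by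
        simpa only [CompactlySupportedContinuousMap.coe_smul, map_smul,
          RingHom.id_apply] using
          (hΛ f).const_smul c) }
    (fun f hf => ge_of_tendsto' (hΛ f) fun i => hpos i f hf)
  have hint : ∀ f : X → ℝ, Continuous f →
      Tendsto (fun i => M i f) U (𝓝 (∫ x, f x ∂(RealRMK.rieszMeasure Λ'))) := by
    intro f hf
    let f' : CompactlySupportedContinuousMap X ℝ :=
      ⟨⟨f, hf⟩, HasCompactSupport.of_compactSpace f⟩
    have : ∫ x, f x ∂(RealRMK.rieszMeasure Λ') = Λ f' := RealRMK.integral_rieszMeasure Λ' f'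
    rw [this]
    exact hΛ f'
  refine ⟨RealRMK.rieszMeasure Λ', ⟨?_⟩, hint⟩
  have h1 := hint 1 continuous_one
  simp only [hone, Pi.one_apply, integral_const, smul_eq_mul, mul_one] at h1
  have h2 := tendsto_nhds_unique tendsto_const_nhds h1
  rw [Measure.real, eq_comm, ENNReal.toReal_eq_one_iff] at h2
  exact h2

/-- The shift of a bi-infinite sequence by `j` places. -/
def shiftBy {G : Type*} (j : ℤ) (x : ℤ → G) : ℤ → G := fun n => x (n + j)

/-- The weight `∑ k, θ k * P k (x (n - k)) g` of the symbol `g` at site `n`, given `x`. -/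
noncomputable def imitationProb {G : Type*} (θ : ℕ → ℝ) (P : ℕ → G → G → ℝ) (n : ℤ)
    (x : ℤ → G) (g : G) : ℝ :=
  ∑' k : ℕ, θ k * P k (x (n - (k : ℤ))) g

lemma imitationProb_shiftBy {G : Type*} (θ : ℕ → ℝ) (P : ℕ → G → G → ℝ) (n j : ℤ)
    (x : ℤ → G) (g : G) :
    imitationProb θ P n (shiftBy j x) g = imitationProb θ P (n + j) x g := by
  simp only [imitationProb, shiftBy, sub_add_eq_add_sub]

lemma update_apply_of_dependsOn_Iio {G β : Type*} {m n : ℤ} (hmn : m ≤ n) {f : (ℤ → G) → β}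
    (hf : DependsOn f (Set.Iio m)) (x : ℤ → G) (g : G) : f (Function.update x n g) = f x :=
  hf fun _ hi => Function.update_of_ne (ne_of_lt (lt_of_lt_of_le hi hmn)) _ _

lemma dependsOn_ite_eq {G : Type*} [DecidableEq G] (n : ℤ) (g : G) :
    DependsOn (fun x : ℤ → G => if x n = g then (1 : ℝ) else 0) (Set.Iio (n + 1)) := by
  intro x y h
  simp only [h n (Set.mem_Iio.2 (lt_add_one n))]

section Resampling

variable {G : Type*} [Fintype G]

/-- The operator resampling site `n` according to the weights `q n`. -/
noncomputable def resample (q : ℤ → (ℤ → G) → G → ℝ) (n : ℤ) :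
    ((ℤ → G) → ℝ) →ₗ[ℝ] ((ℤ → G) → ℝ) where
  toFun f := fun x => ∑ g, q n x g * f (Function.update x n g)
  map_add' f g := by ext x; simp [mul_add, Finset.sum_add_distrib]
  map_smul' c f := by ext x; simp [Finset.mul_sum, mul_left_comm]

/-- The expectation after resampling the sites `0, …, N - 1` in order, starting from a constant
sequence with law `lam`. -/
noncomputable def forwardExpectation (lam : G → ℝ) (q : ℤ → (ℤ → G) → G → ℝ) :
    ℕ → ((ℤ → G) → ℝ) →ₗ[ℝ] ℝ
  | 0 => ∑ g, lam g • LinearMap.proj (R := ℝ) (φ := fun _ : ℤ → G => ℝ) (fun _ => g)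
  | N + 1 => forwardExpectation lam q N ∘ₗ resample q N

/-- The average of the forward expectation over the first `N + 1` positions of the origin. -/
noncomputable def cesaroExpectation (lam : G → ℝ) (q : ℤ → (ℤ → G) → G → ℝ) (N : ℕ) :
    ((ℤ → G) → ℝ) →ₗ[ℝ] ℝ :=
  ((N + 1 : ℝ)⁻¹) • ∑ j ∈ Finset.range (N + 1),
    forwardExpectation lam q (N + 1) ∘ₗ LinearMap.funLeft ℝ ℝ (shiftBy (j : ℤ))

variable {lam : G → ℝ} {q : ℤ → (ℤ → G) → G → ℝ}

lemma resample_apply (n : ℤ) (f : (ℤ → G) → ℝ) (x : ℤ → G) :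
    resample q n f x = ∑ g, q n x g * f (Function.update x n g) := rfl

lemma forwardExpectation_zero_apply (f : (ℤ → G) → ℝ) :
    forwardExpectation lam q 0 f = ∑ g, lam g * f (fun _ => g) := by
  simp [forwardExpectation]

lemma forwardExpectation_succ_apply (N : ℕ) (f : (ℤ → G) → ℝ) :
    forwardExpectation lam q (N + 1) f = forwardExpectation lam q N (resample q N f) := rfl

lemma cesaroExpectation_apply (N : ℕ) (f : (ℤ → G) → ℝ) :
    cesaroExpectation lam q N f = (N + 1 : ℝ)⁻¹ *
      ∑ j ∈ Finset.range (N + 1), forwardExpectation lam q (N + 1) fun x => f (shiftBy j x) := by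
  simp only [cesaroExpectation, LinearMap.smul_apply, LinearMap.sum_apply, smul_eq_mul]
  rfl

lemma resample_of_update_eq (hq1 : ∀ n x, ∑ g, q n x g = 1) {n : ℤ} {f : (ℤ → G) → ℝ}
    (hf : ∀ x g, f (Function.update x n g) = f x) : resample q n f = f := by
  ext x
  simp only [resample_apply, hf, ← Finset.sum_mul, hq1, one_mul]

lemma forwardExpectation_nonneg (hlam : ∀ g, 0 ≤ lam g) (hq0 : ∀ n x g, 0 ≤ q n x g) (N : ℕ) :
    ∀ f, 0 ≤ f → 0 ≤ forwardExpectation lam q N f := by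
  induction N with
  | zero =>
    intro f hf
    rw [forwardExpectation_zero_apply]
    exact Finset.sum_nonneg fun g _ => mul_nonneg (hlam g) (hf _)
  | succ N ih =>
    intro f hf
    refine ih _ fun x => ?_
    exact Finset.sum_nonneg fun g _ => mul_nonneg (hq0 _ _ _) (hf _)

lemma forwardExpectation_one (hlam : ∑ g, lam g = 1) (hq1 : ∀ n x, ∑ g, q n x g = 1) (N : ℕ) :
    forwardExpectation lam q N 1 = 1 := by
  induction N with
  | zero => simp [forwardExpectation_zero_apply, hlam]
  | succ N ih =>
    rw [forwardExpectation_succ_apply, resample_of_update_eq hq1 (fun _ _ => rfl), ih]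

lemma hasSum_forwardExpectation {κ : Type*} (N : ℕ) :
    ∀ {F : κ → (ℤ → G) → ℝ} {f : (ℤ → G) → ℝ}, (∀ x, HasSum (fun k => F k x) (f x)) →
      HasSum (fun k => forwardExpectation lam q N (F k)) (forwardExpectation lam q N f) := by
  induction N with
  | zero =>
    intro F f h
    simp only [forwardExpectation_zero_apply]
    exact hasSum_sum fun g _ => (h _).mul_left _
  | succ N ih =>
    intro F f h
    refine ih fun x => ?_
    exact hasSum_sum fun g _ => (h _).mul_left _

/-- Resampling later sites does not change expectations of functions of the sites up to `n`. -/
lemma forwardExpectation_eq_of_le (hq1 : ∀ n x, ∑ g, q n x g = 1) {n N : ℕ} (hnN : n ≤ N)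
    {f : (ℤ → G) → ℝ} (hf : DependsOn f (Set.Iio (n : ℤ))) :
    forwardExpectation lam q N f = forwardExpectation lam q n f := by
  induction N, hnN using Nat.le_induction with
  | base => rfl
  | succ N hN ih =>
    rw [forwardExpectation_succ_apply, resample_of_update_eq hq1, ih]
    exact fun x g => update_apply_of_dependsOn_Iio (by exact_mod_cast hN) hf x g

lemma cesaroExpectation_nonneg (hlam : ∀ g, 0 ≤ lam g) (hq0 : ∀ n x g, 0 ≤ q n x g) (N : ℕ)
    (f : (ℤ → G) → ℝ) (hf : 0 ≤ f) : 0 ≤ cesaroExpectation lam q N f := by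
  rw [cesaroExpectation_apply]
  exact mul_nonneg (by positivity) (Finset.sum_nonneg fun j _ =>
    forwardExpectation_nonneg hlam hq0 _ _ fun x => hf (shiftBy (j : ℤ) x))

lemma cesaroExpectation_one (hlam : ∑ g, lam g = 1) (hq1 : ∀ n x, ∑ g, q n x g = 1) (N : ℕ) :
    cesaroExpectation lam q N 1 = 1 := by
  have h : ∀ j : ℕ, (fun x : ℤ → G => (1 : (ℤ → G) → ℝ) (shiftBy (j : ℤ) x)) = 1 :=
    fun j => rfl
  simp only [cesaroExpectation_apply, h, forwardExpectation_one hlam hq1, Finset.sum_const,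
    Finset.card_range, nsmul_eq_mul, mul_one]
  push_cast
  exact inv_mul_cancel₀ (by positivity)

lemma abs_forwardExpectation_le (hlam : ∀ g, 0 ≤ lam g) (hlam1 : ∑ g, lam g = 1)
    (hq0 : ∀ n x g, 0 ≤ q n x g) (hq1 : ∀ n x, ∑ g, q n x g = 1) (N : ℕ) {f : (ℤ → G) → ℝ}
    {C : ℝ} (hC : ∀ x, |f x| ≤ C) : |forwardExpectation lam q N f| ≤ C := by
  have h1 := forwardExpectation_nonneg hlam hq0 N (C • 1 - f) fun x => by
    simpa using (abs_le.1 (hC x)).2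
  have h2 := forwardExpectation_nonneg hlam hq0 N (C • 1 + f) fun x => by
    have := (abs_le.1 (hC x)).1
    simp only [Pi.zero_apply, Pi.add_apply, Pi.smul_apply, Pi.one_apply, smul_eq_mul, mul_one]
    linarith
  rw [map_sub, map_smul, forwardExpectation_one hlam1 hq1, smul_eq_mul, mul_one] at h1
  rw [map_add, map_smul, forwardExpectation_one hlam1 hq1, smul_eq_mul, mul_one] at h2
  exact abs_le.2 ⟨by linarith, by linarith⟩

lemma cesaroExpectation_shiftBy_sub (N : ℕ) (f : (ℤ → G) → ℝ) :
    cesaroExpectation lam q N (fun x => f (shiftBy 1 x)) - cesaroExpectation lam q N f =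
      (N + 1 : ℝ)⁻¹ * (forwardExpectation lam q (N + 1) (fun x => f (shiftBy (N + 1 : ℕ) x)) -
        forwardExpectation lam q (N + 1) (fun x => f (shiftBy (0 : ℕ) x))) := by
  have h : ∀ (j : ℕ) (x : ℤ → G),
      shiftBy 1 (shiftBy (j : ℤ) x) = shiftBy ((j + 1 : ℕ) : ℤ) x := fun j x => by
    ext n
    simp only [shiftBy]
    congr 1
    push_cast
    ring
  rw [cesaroExpectation_apply, cesaroExpectation_apply, ← mul_sub, ← Finset.sum_sub_distrib]
  simp only [h]
  rw [Finset.sum_range_sub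
    (fun j : ℕ => forwardExpectation lam q (N + 1) fun x => f (shiftBy (j : ℤ) x))]

lemma tendsto_cesaroExpectation_shiftBy_sub (hlam : ∀ g, 0 ≤ lam g) (hlam1 : ∑ g, lam g = 1)
    (hq0 : ∀ n x g, 0 ≤ q n x g) (hq1 : ∀ n x, ∑ g, q n x g = 1) {f : (ℤ → G) → ℝ}
    {C : ℝ} (hC : ∀ x, |f x| ≤ C) :
    Tendsto (fun N => cesaroExpectation lam q N (fun x => f (shiftBy 1 x)) -
      cesaroExpectation lam q N f) atTop (𝓝 0) := by
  have hlim : Tendsto (fun N : ℕ => (N + 1 : ℝ)⁻¹ * (C + C)) atTop (𝓝 0) := by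
    simpa [one_div] using (tendsto_one_div_add_atTop_nhds_zero_nat (𝕜 := ℝ)).mul_const (C + C)
  refine squeeze_zero_norm (fun N => ?_) hlim
  rw [cesaroExpectation_shiftBy_sub, Real.norm_eq_abs, abs_mul,
    abs_of_nonneg (by positivity : (0 : ℝ) ≤ (N + 1 : ℝ)⁻¹)]
  refine mul_le_mul_of_nonneg_left ((abs_sub _ _).trans (add_le_add ?_ ?_)) (by positivity)
  · exact abs_forwardExpectation_le hlam hlam1 hq0 hq1 _ fun x => hC _
  · exact abs_forwardExpectation_le hlam hlam1 hq0 hq1 _ fun x => hC _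

variable [DecidableEq G]

lemma resample_mul_ite (n : ℤ) (g : G)
    {φ : (ℤ → G) → ℝ} (hφ : DependsOn φ (Set.Iio n)) :
    resample q n (fun x => φ x * if x n = g then (1 : ℝ) else 0) = fun x => φ x * q n x g := by
  ext x
  simp [resample_apply, update_apply_of_dependsOn_Iio le_rfl hφ, mul_comm]

/-- The forward expectation is compatible with `q` at every resampled site. -/
lemma forwardExpectation_mul_ite (hq1 : ∀ n x, ∑ g, q n x g = 1)
    (hqd : ∀ n g, DependsOn (fun x => q n x g) (Set.Iio n)) {n N : ℕ} (hnN : n < N) (g : G)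
    {φ : (ℤ → G) → ℝ} (hφ : DependsOn φ (Set.Iio (n : ℤ))) :
    forwardExpectation lam q N (fun x => φ x * if x n = g then (1 : ℝ) else 0) =
      forwardExpectation lam q N (fun x => φ x * q n x g) := by
  have h2 : DependsOn (fun x => φ x * q n x g) (Set.Iio (n : ℤ)) := fun x y h => by
    have h' := hqd n g h
    simp only at h'
    simp only [hφ h, h']
  rw [forwardExpectation_eq_of_le hq1 hnN.le h2, forwardExpectation_eq_of_le hq1 hnN,
    forwardExpectation_succ_apply, resample_mul_ite n g hφ]
  intro x y h
  have h1 := dependsOn_ite_eq (n : ℤ) g (x := x) (y := y) (fun i hi => h i (by simpa using hi))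
  simp only at h1
  simp only [h1, hφ fun i hi => h i (by
    have := Set.mem_Iio.1 hi
    exact Set.mem_Iio.2 (by push_cast; omega))]

lemma cesaroExpectation_mul_ite (hq1 : ∀ n x, ∑ g, q n x g = 1)
    (hqd : ∀ n g, DependsOn (fun x => q n x g) (Set.Iio n))
    (hqs : ∀ n j x g, q n (shiftBy j x) g = q (n + j) x g) (N : ℕ) (g : G)
    {φ : (ℤ → G) → ℝ} (hφ : DependsOn φ (Set.Iio 0)) :
    cesaroExpectation lam q N (fun x => φ x * if x 0 = g then (1 : ℝ) else 0) =
      cesaroExpectation lam q N (fun x => φ x * q 0 x g) := by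
  rw [cesaroExpectation_apply, cesaroExpectation_apply]
  congr 1
  refine Finset.sum_congr rfl fun j hj => ?_
  have hd : DependsOn (fun x : ℤ → G => φ (shiftBy j x)) (Set.Iio (j : ℤ)) := fun x y h =>
    hφ fun i hi => h (i + j) (by simpa using hi)
  have := forwardExpectation_mul_ite (lam := lam) hq1 hqd (Finset.mem_range.1 hj) g hd
  simpa only [hqs, zero_add, shiftBy] using this

end Resampling

section ImitationProb

variable {G : Type*} [Fintype G] {θ : ℕ → ℝ} {P : ℕ → G → G → ℝ}

lemma mul_apply_le_of_sum_eq (h0 : ∀ k i j, 0 ≤ θ k * P k i j)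
    (hrow : ∀ k i, ∑ j, θ k * P k i j = θ k) (k : ℕ) (i j : G) : θ k * P k i j ≤ θ k :=
  (Finset.single_le_sum (fun j _ => h0 k i j) (Finset.mem_univ j)).trans_eq (hrow k i)

lemma hasSum_imitationProb (hθ : HasSum θ 1) (h0 : ∀ k i j, 0 ≤ θ k * P k i j)
    (hrow : ∀ k i, ∑ j, θ k * P k i j = θ k) (n : ℤ) (x : ℤ → G) (g : G) :
    HasSum (fun k : ℕ => θ k * P k (x (n - (k : ℤ))) g) (imitationProb θ P n x g) :=
  (Summable.of_nonneg_of_le (fun _ => h0 _ _ _)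
    (fun _ => mul_apply_le_of_sum_eq h0 hrow _ _ _) hθ.summable).hasSum

lemma sum_imitationProb (hθ : HasSum θ 1) (h0 : ∀ k i j, 0 ≤ θ k * P k i j)
    (hrow : ∀ k i, ∑ j, θ k * P k i j = θ k) (n : ℤ) (x : ℤ → G) :
    ∑ g, imitationProb θ P n x g = 1 := by
  have h := hasSum_sum fun g (_ : g ∈ Finset.univ) => hasSum_imitationProb hθ h0 hrow n x g
  simp only [hrow] at h
  exact h.unique hθ

lemma dependsOn_imitationProb {G : Type*} {θ : ℕ → ℝ} {P : ℕ → G → G → ℝ} (hθ0 : θ 0 = 0)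
    (n : ℤ) (g : G) : DependsOn (fun x => imitationProb θ P n x g) (Set.Iio n) := by
  intro x y h
  refine tsum_congr fun k => ?_
  rcases Nat.eq_zero_or_pos k with rfl | hk
  · simp [hθ0]
  · rw [h _ (Set.mem_Iio.2 (by omega))]

lemma continuous_imitationProb [TopologicalSpace G] [DiscreteTopology G] (hθ : HasSum θ 1)
    (h0 : ∀ k i j, 0 ≤ θ k * P k i j) (hrow : ∀ k i, ∑ j, θ k * P k i j = θ k) (n : ℤ) (g : G) :
    Continuous fun x => imitationProb θ P n x g := by
  refine continuous_tsum (u := θ) (fun k => ?_) hθ.summable fun k x => ?_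
  · exact (continuous_of_discreteTopology (f := fun i => θ k * P k i g)).comp
      (continuous_apply (n - (k : ℤ)))
  · rw [Real.norm_eq_abs, abs_of_nonneg (h0 _ _ _)]
    exact mul_apply_le_of_sum_eq h0 hrow _ _ _

variable [DecidableEq G] {lam : G → ℝ}

/-- Every site has law `lam` under the forward expectation. -/
lemma forwardExpectation_imitationProb_ite (hθ : HasSum θ 1) (h0 : ∀ k i j, 0 ≤ θ k * P k i j)
    (hrow : ∀ k i, ∑ j, θ k * P k i j = θ k)
    (hinv : ∀ g, ∑' k : ℕ, θ k * ∑ i, lam i * P k i g = lam g) (N : ℕ) :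
    ∀ (n : ℤ) (g : G), forwardExpectation lam (imitationProb θ P) N
      (fun x => if x n = g then (1 : ℝ) else 0) = lam g := by
  induction N with
  | zero => intro n g; simp [forwardExpectation_zero_apply]
  | succ N ih =>
    intro n g
    rw [forwardExpectation_succ_apply]
    rcases eq_or_ne n N with rfl | hn
    · have h1 := resample_mul_ite (q := imitationProb θ P) (N : ℤ) g (φ := fun _ => 1)
        (fun _ _ _ => rfl)
      simp only [one_mul] at h1
      rw [h1, ← (hasSum_forwardExpectation N fun x =>
        hasSum_imitationProb hθ h0 hrow (N : ℤ) x g).tsum_eq, ← hinv g]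
      refine tsum_congr fun k => ?_
      have h2 : (fun x : ℤ → G => θ k * P k (x ((N : ℤ) - (k : ℤ))) g) =
          ∑ i, (θ k * P k i g) • fun x => if x ((N : ℤ) - (k : ℤ)) = i then (1 : ℝ) else 0 := by
        ext x
        simp
      rw [h2, map_sum, Finset.mul_sum]
      refine Finset.sum_congr rfl fun i _ => ?_
      rw [map_smul, ih, smul_eq_mul]
      ring
    · rw [resample_of_update_eq (sum_imitationProb hθ h0 hrow), ih]
      intro x a
      rw [Function.update_of_ne hn]

lemma cesaroExpectation_imitationProb_ite (hθ : HasSum θ 1)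
    (h0 : ∀ k i j, 0 ≤ θ k * P k i j) (hrow : ∀ k i, ∑ j, θ k * P k i j = θ k)
    (hinv : ∀ g, ∑' k : ℕ, θ k * ∑ i, lam i * P k i g = lam g) (N : ℕ) (n : ℤ) (g : G) :
    cesaroExpectation lam (imitationProb θ P) N (fun x => if x n = g then (1 : ℝ) else 0) =
      lam g := by
  have h (j : ℕ) : forwardExpectation lam (imitationProb θ P) (N + 1)
      (fun x => if shiftBy j x n = g then (1 : ℝ) else 0) = lam g :=
    forwardExpectation_imitationProb_ite hθ h0 hrow hinv (N + 1) (n + j) g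
  simp only [cesaroExpectation_apply, h, Finset.sum_const, Finset.card_range, nsmul_eq_mul]
  push_cast
  exact inv_mul_cancel_left₀ (by positivity) _

end ImitationProb

lemma shiftBy_zero {G : Type*} (x : ℤ → G) : shiftBy 0 x = x := by
  ext n
  rw [shiftBy, add_zero]

lemma continuous_shiftBy {G : Type*} [TopologicalSpace G] (j : ℤ) :
    Continuous (shiftBy j : (ℤ → G) → ℤ → G) :=
  continuous_pi fun n => continuous_apply (n + j)

lemma continuous_ite_eq {G : Type*} [DecidableEq G] [TopologicalSpace G] [DiscreteTopology G]
    (n : ℤ) (g : G) :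
    Continuous fun x : ℤ → G => if x n = g then (1 : ℝ) else 0 :=
  (continuous_of_discreteTopology (f := fun i : G => if i = g then (1 : ℝ) else 0)).comp
    (continuous_apply n)

section Stationary

lemma integral_shiftBy_eq {G : Type*} [MeasurableSpace G] [TopologicalSpace G]
    {μ : Measure (ℤ → G)}
    (h : ∀ f : (ℤ → G) → ℝ, Continuous f → ∫ x, f (shiftBy 1 x) ∂μ = ∫ x, f x ∂μ) (m : ℤ) :
    ∀ f : (ℤ → G) → ℝ, Continuous f → ∫ x, f (shiftBy m x) ∂μ = ∫ x, f x ∂μ := by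
  have hs : ∀ (a : ℤ) (x : ℤ → G), shiftBy a (shiftBy 1 x) = shiftBy (a + 1) x := fun a x => by
    ext n
    simp only [shiftBy, add_assoc]
  intro f hf
  have hstep : ∀ a : ℤ, ∫ x, f (shiftBy (a + 1) x) ∂μ = ∫ x, f (shiftBy a x) ∂μ := fun a => by
    simpa only [hs, Function.comp_apply] using h (f ∘ shiftBy a) (hf.comp (continuous_shiftBy a))
  induction m using Int.induction_on with
  | zero => simp only [shiftBy_zero]
  | succ i ih => rw [hstep, ih]
  | pred i ih => rw [← ih, ← hstep, sub_add_cancel]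

variable {G : Type*} [DecidableEq G] [MeasurableSpace G]

lemma exists_stationary_integral_eq [Fintype G] [TopologicalSpace G] [DiscreteTopology G]
    [BorelSpace (ℤ → G)] {θ : ℕ → ℝ} {P : ℕ → G → G → ℝ} {lam : G → ℝ} (hθ : HasSum θ 1)
    (hθ0 : θ 0 = 0) (h0 : ∀ k i j, 0 ≤ θ k * P k i j)
    (hrow : ∀ k i, ∑ j, θ k * P k i j = θ k)
    (hlam : ∀ g, 0 ≤ lam g) (hlam1 : ∑ g, lam g = 1)
    (hinv : ∀ g, ∑' k : ℕ, θ k * ∑ i, lam i * P k i g = lam g) :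
    ∃ μ : Measure (ℤ → G), IsProbabilityMeasure μ ∧
      (∀ f : (ℤ → G) → ℝ, Continuous f → ∫ x, f (shiftBy 1 x) ∂μ = ∫ x, f x ∂μ) ∧
      (∀ (φ : (ℤ → G) → ℝ) (g : G), Continuous φ → DependsOn φ (Set.Iio 0) →
        ∫ x, φ x * (if x 0 = g then (1 : ℝ) else 0) ∂μ =
          ∫ x, φ x * imitationProb θ P 0 x g ∂μ) ∧
      ∀ (n : ℤ) (g : G), ∫ x, (if x n = g then (1 : ℝ) else 0) ∂μ = lam g := by
  have hq0 : ∀ n x g, 0 ≤ imitationProb θ P n x g := fun n x g => tsum_nonneg fun _ => h0 _ _ _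
  have hq1 := sum_imitationProb hθ h0 hrow
  obtain ⟨μ, hμ, hlim⟩ := exists_isProbabilityMeasure_tendsto_integral (hyperfilter ℕ)
    (cesaroExpectation lam (imitationProb θ P)) (cesaroExpectation_nonneg hlam hq0)
    (cesaroExpectation_one hlam1 hq1)
  refine ⟨μ, hμ, fun f hf => ?_, fun φ g hφ hd => ?_, fun n g => ?_⟩
  · obtain ⟨C, hC⟩ := isCompact_univ.exists_bound_of_continuousOn hf.continuousOn
    have h1 := (tendsto_cesaroExpectation_shiftBy_sub hlam hlam1 hq0 hq1
      fun x => hC x (Set.mem_univ x)).mono_left Nat.hyperfilter_le_atTop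
    exact sub_eq_zero.1 (tendsto_nhds_unique
      ((hlim _ (hf.comp (continuous_shiftBy 1))).sub (hlim f hf)) h1)
  · have h1 := hlim (fun x => φ x * _) (hφ.mul (continuous_ite_eq 0 g))
    have h2 := hlim (fun x => φ x * _) (hφ.mul (continuous_imitationProb hθ h0 hrow 0 g))
    simp only [cesaroExpectation_mul_ite hq1 (dependsOn_imitationProb hθ0)
      (imitationProb_shiftBy θ P) _ g hd] at h1
    exact tendsto_nhds_unique h1 h2
  · have h1 := hlim _ (continuous_ite_eq n g)
    simp only [cesaroExpectation_imitationProb_ite hθ h0 hrow hinv] at h1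
    exact tendsto_nhds_unique h1 tendsto_const_nhds

/-- A stationary measure compatible with `q` at the origin, when tested against continuous
functions, is compatible with `q` at every site. -/
lemma measure_inter_eq_setIntegral [Finite G] [TopologicalSpace G] [DiscreteTopology G]
    [MeasurableSingletonClass G] {μ : Measure (ℤ → G)} [IsProbabilityMeasure μ]
    {q : ℤ → (ℤ → G) → G → ℝ} (hq0 : ∀ n x g, 0 ≤ q n x g)
    (hqc : ∀ n g, Continuous fun x => q n x g)
    (hqs : ∀ n j x g, q n (shiftBy j x) g = q (n + j) x g)
    (hshift : ∀ f : (ℤ → G) → ℝ, Continuous f → ∫ x, f (shiftBy 1 x) ∂μ = ∫ x, f x ∂μ)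
    (horigin : ∀ (φ : (ℤ → G) → ℝ) (g : G), Continuous φ → DependsOn φ (Set.Iio 0) →
        ∫ x, φ x * (if x 0 = g then (1 : ℝ) else 0) ∂μ = ∫ x, φ x * q 0 x g ∂μ)
    (n : ℤ) (g : G) {E : Set (ℤ → G)} (hE : PastMeasurable n E) :
    (μ (E ∩ {x | x n = g})).toReal = ∫ x in E, q n x g ∂μ := by
  let π : (ℤ → G) → ({m : ℤ // m < n} → G) := fun x m => x m.1
  have hπ : Measurable π := measurable_pi_lambda _ fun m => measurable_pi_apply _
  have hπc : Continuous π := continuous_pi fun m => continuous_apply _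
  have hD : MeasurableSet {x : ℤ → G | x n = g} :=
    measurableSet_eq_fun (measurable_pi_apply n) measurable_const
  obtain ⟨B, hB, rfl⟩ := hE
  change MeasurableSet B at hB
  have hqi : Integrable (fun x => q n x g) μ := by
    obtain ⟨C, hC⟩ := isCompact_univ.exists_bound_of_continuousOn (hqc n g).continuousOn
    exact .of_bound (hqc n g).measurable.aestronglyMeasurable C
      (.of_forall fun x => hC x (Set.mem_univ x))
  have hqm : Measurable fun x => ENNReal.ofReal (q n x g) := (hqc n g).measurable.ennreal_ofReal
  have : IsFiniteMeasure (μ.withDensity fun x => ENNReal.ofReal (q n x g)) :=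
    isFiniteMeasure_withDensity_ofReal hqi.2
  have key : (μ.restrict {x | x n = g}).map π =
      (μ.withDensity fun x => ENNReal.ofReal (q n x g)).map π := by
    refine ext_of_forall_integral_eq_of_IsFiniteMeasure fun f => ?_
    have hfc : Continuous fun x => f (π x) := f.continuous.comp hπc
    rw [integral_map hπ.aemeasurable f.continuous.measurable.aestronglyMeasurable,
      integral_map hπ.aemeasurable f.continuous.measurable.aestronglyMeasurable,
      integral_withDensity_eq_integral_toReal_smul hqm (.of_forall fun _ => ENNReal.ofReal_lt_top),
      ← integral_indicator hD]
    have hback : ∀ x : ℤ → G, shiftBy (-n) (shiftBy n x) = x := fun x => by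
      ext k
      simp [shiftBy]
    have hφc : Continuous fun x => f (π (shiftBy (-n) x)) := hfc.comp (continuous_shiftBy _)
    have h1 := horigin (fun x => f (π (shiftBy (-n) x))) g hφc (fun x y h => by
      have hxy : π (shiftBy (-n) x) = π (shiftBy (-n) y) := funext fun m =>
        h _ (Set.mem_Iio.2 (by have := m.2; omega))
      simp only [hxy])
    rw [← integral_shiftBy_eq hshift n (fun x => _ * _) (hφc.mul (continuous_ite_eq 0 g)),
      ← integral_shiftBy_eq hshift n (fun x => _ * _) (hφc.mul (hqc 0 g))] at h1
    simp only [hback, hqs, zero_add] at h1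
    convert h1 using 3 with x x
    · simp [Set.indicator_apply, shiftBy]
    · rw [ENNReal.toReal_ofReal (hq0 _ _ _), smul_eq_mul, mul_comm]
  have h2 := congrArg (fun ν => ν B) key
  simp only [Measure.map_apply hπ hB, Measure.restrict_apply (hπ hB),
    withDensity_apply _ (hπ hB)] at h2
  change (μ (π ⁻¹' B ∩ _)).toReal = ∫ x in π ⁻¹' B, _ ∂μ
  rw [h2, integral_eq_lintegral_of_nonneg_ae (.of_forall fun x => hq0 _ _ _)
    (hqc n g).measurable.aestronglyMeasurable]

end Stationary

/-- any invariant probability vector `λ` of `P̂ = ∑_k θ_k P_(k)`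
is the single-site marginal of some shift-invariant element of `𝒢(p)`. -/
theorem stmt_9 {G : Type*} [Fintype G] [DecidableEq G] [Nonempty G]
    [MeasurableSpace G] [MeasurableSingletonClass G]
    (A : Set ℕ) (hA : A.Nonempty) (hApos : ∀ k ∈ A, 0 < k)
    (θ : ℕ → ℝ) (hθpos : ∀ k ∈ A, 0 < θ k) (hθ0 : ∀ k, k ∉ A → θ k = 0)
    (hθsum : HasSum θ 1)
    (P : ℕ → G → G → ℝ)
    (hPnn : ∀ k ∈ A, ∀ i j : G, 0 ≤ P k i j)
    (hProw : ∀ k ∈ A, ∀ i : G, ∑ j, P k i j = 1)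
    (lam : G → ℝ) (hlamnn : ∀ g : G, 0 ≤ lam g) (hlamsum : ∑ g, lam g = 1)
    (hinv : ∀ g : G, ∑' k : ℕ, θ k * ∑ i, lam i * P k i g = lam g) :
    ∃ μ : Measure (ℤ → G),
      IsProbabilityMeasure μ ∧ Compatible θ P μ ∧
      Measure.map (fun x : ℤ → G => fun n : ℤ => x (n + 1)) μ = μ ∧
      (∀ (n : ℤ) (g : G), (μ {x : ℤ → G | x n = g}).toReal = lam g) := by
  have h0 : ∀ k i j, 0 ≤ θ k * P k i j := fun k i j => by
    by_cases hk : k ∈ A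
    · exact mul_nonneg (hθpos k hk).le (hPnn k hk i j)
    · simp [hθ0 k hk]
  have hrow : ∀ k i, ∑ j, θ k * P k i j = θ k := fun k i => by
    by_cases hk : k ∈ A
    · rw [← Finset.mul_sum, hProw k hk, mul_one]
    · simp [hθ0 k hk]
  let _ : TopologicalSpace G := ⊥
  have : DiscreteTopology G := ⟨rfl⟩
  obtain ⟨μ, hμ, hshift, horigin, hmarg⟩ := exists_stationary_integral_eq hθsum
    (hθ0 0 fun h => (hApos 0 h).ne rfl) h0 hrow hlamnn hlamsum hinv
  refine ⟨μ, hμ, fun n g E hE => ?_, ?_, fun n g => ?_⟩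
  · exact measure_inter_eq_setIntegral (q := imitationProb θ P)
      (fun n x g => tsum_nonneg fun _ => h0 _ _ _) (continuous_imitationProb hθsum h0 hrow)
      (imitationProb_shiftBy θ P) hshift horigin n g hE
  · have hm : Measurable (shiftBy 1 : (ℤ → G) → ℤ → G) := (continuous_shiftBy 1).measurable
    change Measure.map (shiftBy 1) μ = μ
    have := Measure.isProbabilityMeasure_map hm.aemeasurable (μ := μ)
    refine ext_of_forall_integral_eq_of_IsFiniteMeasure fun f => ?_
    rw [integral_map hm.aemeasurable f.continuous.measurable.aestronglyMeasurable,
      hshift f f.continuous]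
  · have hD : MeasurableSet {x : ℤ → G | x n = g} :=
      measurableSet_eq_fun (measurable_pi_apply n) measurable_const
    rw [← hmarg n g, ← Measure.real, ← integral_indicator_one hD]
    refine integral_congr_ae (.of_forall fun x => ?_)
    simp [Set.indicator_apply]
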